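/- Let Λ ⊂ ℝ³ be a singular-hyperbolic set of the flow φ whose periodic orbits contained in Λ are dense in Λ, and let H ⊆ Λ be a compact invariant set containing no singularity of X. Then H is hyperbolic of saddle type: there are continuous maps x ↦ F^s(x), F^u(x) (one-dimensional subspaces of ℝ³ for x ∈ H) with ℝ³ = F^s(x) ⊕ span(X(x)) ⊕ F^u(x), invariance Dφ_t(x)F^s(x) = F^s(φ_t(x)) and Dφ_t(x)F^u(x) = F^u(φ_t(x)) for all t, and constants C ≥ 1, μ > 0 such that for all x ∈ H and t ≥ 0: ‖Dφ_t(x)v‖ ≤ C e^{−μt}‖v‖ for v ∈ F^s(x), and ‖Dφ_{−t}(x)v‖ ≤ C e^{−μt}‖v‖ for v ∈ F^u(x). -/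

import Mathlib

open Filter Metric Topology Set
open scoped ENNReal NNReal

noncomputable section

/-- ℝ³, modelled as `Fin 3 → ℝ`. -/
abbrev V3 := Fin 3 → ℝ

/-- `φ` is a complete flow generated by the vector field `X`. -/
def IsFlowOf (X : V3 → V3) (φ : ℝ → V3 → V3) : Prop :=
  Continuous (fun q : ℝ × V3 => φ q.1 q.2) ∧
  (∀ x, φ 0 x = x) ∧
  (∀ s t x, φ (s + t) x = φ s (φ t x)) ∧
  (∀ t, ContDiff ℝ 1 (φ t)) ∧
  (∀ x t, HasDerivAt (fun s => φ s x) (X (φ t x)) t)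

/-- derivative of the time-`t` map at `x`. -/
def Dphi (φ : ℝ → V3 → V3) (t : ℝ) (x : V3) : V3 →L[ℝ] V3 := fderiv ℝ (φ t) x

def FlowInv (φ : ℝ → V3 → V3) (Λ : Set V3) : Prop := ∀ t, φ t '' Λ = Λ

def omegaLim (φ : ℝ → V3 → V3) (p : V3) : Set V3 :=
  {x | ∃ τ : ℕ → ℝ, Tendsto τ atTop atTop ∧ Tendsto (fun n => φ (τ n) p) atTop (𝓝 x)}

def TransitiveSet (φ : ℝ → V3 → V3) (Λ : Set V3) : Prop :=
  ∃ p ∈ Λ, omegaLim φ p = Λ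

def IsIsolating (φ : ℝ → V3 → V3) (Λ U : Set V3) : Prop :=
  IsOpen U ∧ Bornology.IsBounded U ∧ Λ ⊆ U ∧
    (∀ t > 0, φ t '' closure U ⊆ U) ∧ Λ = ⋂ t ∈ Ioi (0 : ℝ), φ t '' U

def Attracting (φ : ℝ → V3 → V3) (Λ : Set V3) : Prop :=
  ∃ U : Set V3, IsIsolating φ Λ U

def orb (φ : ℝ → V3 → V3) (p : V3) : Set V3 := range fun t => φ t p

def IsPeriodicPt (X : V3 → V3) (φ : ℝ → V3 → V3) (p : V3) : Prop :=
  X p ≠ 0 ∧ ∃ T > 0, φ T p = p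

/-- union of the periodic orbits of `X` contained in `Λ`. -/
def PerSet (X : V3 → V3) (φ : ℝ → V3 → V3) (Λ : Set V3) : Set V3 :=
  {p | IsPeriodicPt X φ p ∧ orb φ p ⊆ Λ}

/-- points on closed orbits (singularities and periodic points). -/
def ClosedOrbitPts (φ : ℝ → V3 → V3) : Set V3 := {x | ∃ T > 0, φ T x = x}

def WsSing (φ : ℝ → V3 → V3) (σ : V3) : Set V3 :=
  {x | Tendsto (fun t : ℝ => φ t x) atTop (𝓝 σ)}

def WuSing (φ : ℝ → V3 → V3) (σ : V3) : Set V3 :=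
  {x | Tendsto (fun t : ℝ => φ (-t) x) atTop (𝓝 σ)}

def WsOrb (φ : ℝ → V3 → V3) (O : Set V3) : Set V3 :=
  {x | Tendsto (fun t : ℝ => infDist (φ t x) O) atTop (𝓝 0)}

def WuOrb (φ : ℝ → V3 → V3) (O : Set V3) : Set V3 :=
  {x | Tendsto (fun t : ℝ => infDist (φ (-t) x) O) atTop (𝓝 0)}

/-- stable manifold of the orbit of a periodic point. -/
def WsPer (φ : ℝ → V3 → V3) (p : V3) : Set V3 := WsOrb φ (orb φ p)

/-- unstable manifold of the orbit of a periodic point. -/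
def WuPer (φ : ℝ → V3 → V3) (p : V3) : Set V3 := WuOrb φ (orb φ p)

/-- `σ` is a hyperbolic singularity: every complex eigenvalue of `DX(σ)` has
nonzero real part. -/
def HypSing (X : V3 → V3) (σ : V3) : Prop :=
  ∀ μ : ℂ, Module.End.HasEigenvalue
    (LinearMap.baseChange ℂ ((fderiv ℝ X σ : V3 →ₗ[ℝ] V3))) μ → μ.re ≠ 0

/-- `Λ` is a singular-hyperbolic set of the flow `φ` of `X`. -/
structure SingHyp (X : V3 → V3) (φ : ℝ → V3 → V3) (Λ : Set V3) : Prop where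
  compact : IsCompact Λ
  invariant : FlowInv φ Λ
  exSing : ∃ σ ∈ Λ, X σ = 0
  hypSing : ∀ σ ∈ Λ, X σ = 0 → HypSing X σ
  splitting : ∃ (Es Ec : V3 → Submodule ℝ V3) (K lam : ℝ),
    1 ≤ K ∧ 0 < lam ∧
    (∀ x ∈ Λ, Module.finrank ℝ (Es x) = 1) ∧
    (∀ x ∈ Λ, Module.finrank ℝ (Ec x) = 2) ∧
    (∀ x ∈ Λ, Es x ⊓ Ec x = ⊥) ∧
    (∀ x ∈ Λ, Es x ⊔ Ec x = ⊤) ∧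
    -- continuity of the subbundles, expressed by closedness of their total spaces
    IsClosed {q : V3 × V3 | q.1 ∈ Λ ∧ q.2 ∈ Es q.1} ∧
    IsClosed {q : V3 × V3 | q.1 ∈ Λ ∧ q.2 ∈ Ec q.1} ∧
    -- invariance
    (∀ x ∈ Λ, ∀ t : ℝ, (Es x).map (Dphi φ t x : V3 →ₗ[ℝ] V3) = Es (φ t x)) ∧
    (∀ x ∈ Λ, ∀ t : ℝ, (Ec x).map (Dphi φ t x : V3 →ₗ[ℝ] V3) = Ec (φ t x)) ∧
    -- contraction of Es
    (∀ x ∈ Λ, ∀ t ≥ 0, ∀ v ∈ Es x,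
      ‖Dphi φ t x v‖ ≤ K * Real.exp (-lam * t) * ‖v‖) ∧
    -- domination
    (∀ x ∈ Λ, ∀ t ≥ 0, ∀ v ∈ Es x, ∀ w ∈ Ec x,
      ‖Dphi φ t x v‖ * ‖w‖ ≤ K * Real.exp (-lam * t) * (‖v‖ * ‖Dphi φ t x w‖)) ∧
    -- volume expansion of the central direction
    (∀ x ∈ Λ, ∀ t ≥ 0, ∀ u ∈ Ec x, ∀ w ∈ Ec x,
      K⁻¹ * Real.exp (lam * t) * ‖crossProduct u w‖ ≤
        ‖crossProduct (Dphi φ t x u) (Dphi φ t x w)‖)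

/-- `σ` is Lorenz-like, with real eigenvalues `l2 < l3 < 0 < -l3 < l1`. -/
def LorenzLikeWith (X : V3 → V3) (σ : V3) (l1 l2 l3 : ℝ) : Prop :=
  l2 < l3 ∧ l3 < 0 ∧ -l3 < l1 ∧
  Module.End.HasEigenvalue (fderiv ℝ X σ : V3 →ₗ[ℝ] V3) l1 ∧
  Module.End.HasEigenvalue (fderiv ℝ X σ : V3 →ₗ[ℝ] V3) l2 ∧
  Module.End.HasEigenvalue (fderiv ℝ X σ : V3 →ₗ[ℝ] V3) l3 ∧
  ∀ μ : ℂ, Module.End.HasEigenvalue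
      (LinearMap.baseChange ℂ ((fderiv ℝ X σ : V3 →ₗ[ℝ] V3))) μ →
    μ = (l1 : ℂ) ∨ μ = (l2 : ℂ) ∨ μ = (l3 : ℂ)

def LorenzLike (X : V3 → V3) (σ : V3) : Prop :=
  ∃ l1 l2 l3 : ℝ, LorenzLikeWith X σ l1 l2 l3

/-- strong stable manifold of a Lorenz-like singularity with middle eigenvalue `l3`. -/
def Wss (φ : ℝ → V3 → V3) (σ : V3) (l3 : ℝ) : Set V3 :=
  {x ∈ WsSing φ σ | limsup (fun t : ℝ => Real.log ‖φ t x - σ‖ / t) atTop < l3}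

/-- `A` is a connected component of `S`. -/
def IsCCOf (S A : Set V3) : Prop := ∃ x ∈ S, A = connectedComponentIn S x

/-- `A`, `B` are the two connected components of `S`. -/
def TwoComponents (S A B : Set V3) : Prop :=
  IsCCOf S A ∧ IsCCOf S B ∧ Disjoint A B ∧ A ∪ B = S

/-- Standing hypotheses (H). -/
structure StandingH (X : V3 → V3) (φ : ℝ → V3 → V3) (Λ : Set V3) (σ : V3)
    (l1 l2 l3 : ℝ) (Wsp Wsm : Set V3) : Prop where
  flow : IsFlowOf X φ
  singHyp : SingHyp X φ Λ
  connected : IsConnected Λ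
  attracting : Attracting φ Λ
  denseClosed : Λ ⊆ closure {x | x ∈ Λ ∧ x ∈ ClosedOrbitPts φ}
  sigmaMem : σ ∈ Λ
  sigmaSing : X σ = 0
  uniqueSing : ∀ x ∈ Λ, X x = 0 → x = σ
  lorenz : LorenzLikeWith X σ l1 l2 l3
  ssInter : Λ ∩ Wss φ σ l3 = {σ}
  comps : TwoComponents (WsSing φ σ \ Wss φ σ l3) Wsp Wsm

/-- nonwandering set of a flow. -/
def NonWandering (ψ : ℝ → V3 → V3) : Set V3 :=
  {x | ∀ V : Set V3, IsOpen V → x ∈ V → ∀ T > 0, ∃ t > T, (ψ t '' V ∩ V).Nonempty}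

/-- `C^r` distance between two vector fields, valued in `ℝ≥0∞`. -/
def dCr (r : ℕ) (X Y : V3 → V3) : ℝ≥0∞ :=
  ∑ k ∈ Finset.range (r + 1),
    ⨆ x : V3, (‖iteratedFDeriv ℝ k X x - iteratedFDeriv ℝ k Y x‖₊ : ℝ≥0∞)

section CrossProductNorm

lemma norm_crossProduct_le (u w : V3) : ‖crossProduct u w‖ ≤ 2 * (‖u‖ * ‖w‖) := by
  have h : ∀ i j k l, |u i * w j - u k * w l| ≤ 2 * (‖u‖ * ‖w‖) := by
    intro i j k l
    have h1 : |u i * w j| ≤ ‖u‖ * ‖w‖ := by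
      rw [abs_mul]
      exact mul_le_mul (norm_le_pi_norm u i) (norm_le_pi_norm w j) (abs_nonneg _) (norm_nonneg _)
    have h2 : |u k * w l| ≤ ‖u‖ * ‖w‖ := by
      rw [abs_mul]
      exact mul_le_mul (norm_le_pi_norm u k) (norm_le_pi_norm w l) (abs_nonneg _) (norm_nonneg _)
    linarith [abs_sub (u i * w j) (u k * w l)]
  rw [pi_norm_le_iff_of_nonneg (by positivity), cross_apply]
  intro i
  fin_cases i <;> exact h _ _ _ _

lemma abs_mul_sub_mul_le_norm_crossProduct (u w : V3) (i j : Fin 3) :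
    |u j * w i - u i * w j| ≤ ‖crossProduct u w‖ := by
  have h0 : |u 1 * w 2 - u 2 * w 1| ≤ ‖crossProduct u w‖ := norm_le_pi_norm (crossProduct u w) 0
  have h1 : |u 2 * w 0 - u 0 * w 2| ≤ ‖crossProduct u w‖ := norm_le_pi_norm (crossProduct u w) 1
  have h2 : |u 0 * w 1 - u 1 * w 0| ≤ ‖crossProduct u w‖ := norm_le_pi_norm (crossProduct u w) 2
  fin_cases i <;> fin_cases j
  all_goals first
    | (rw [sub_self, abs_zero]; exact norm_nonneg _)
    | assumption
    | (rw [abs_sub_comm]; assumption)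

/-- Up to a multiple of `w`, the vector `u` is controlled by `u × w`. -/
lemma exists_norm_sub_smul_mul_norm_le (u w : V3) :
    ∃ c : ℝ, ‖u - c • w‖ * ‖w‖ ≤ ‖crossProduct u w‖ := by
  obtain ⟨i, hi⟩ : ∃ i, ‖w‖ = |w i| := by
    obtain ⟨i, -, hi⟩ := Finset.exists_mem_eq_sup' Finset.univ_nonempty (fun i => ‖w i‖)
    refine ⟨i, le_antisymm ?_ (norm_le_pi_norm w i)⟩
    rw [pi_norm_le_iff_of_nonneg (abs_nonneg _)]
    intro j
    have := Finset.le_sup' (fun i => ‖w i‖) (Finset.mem_univ j)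
    rw [hi] at this
    exact this
  by_cases hw : w i = 0
  · exact ⟨0, by simp [hi, hw]⟩
  refine ⟨u i / w i, ?_⟩
  have hpos : 0 < ‖w‖ := by rw [hi]; exact abs_pos.2 hw
  rw [← le_div_iff₀ hpos, pi_norm_le_iff_of_nonneg (by positivity)]
  intro j
  rw [le_div_iff₀ hpos, hi, Real.norm_eq_abs, ← abs_mul]
  have e : (u - (u i / w i) • w) j * w i = u j * w i - u i * w j := by
    simp only [Pi.sub_apply, Pi.smul_apply, smul_eq_mul]
    field_simp
  rw [e]
  exact abs_mul_sub_mul_le_norm_crossProduct u w i j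

end CrossProductNorm

section FlowBasics

variable {X : V3 → V3} {φ : ℝ → V3 → V3}

lemma IsFlowOf.hasFDerivAt (h : IsFlowOf X φ) (t : ℝ) (x : V3) :
    HasFDerivAt (φ t) (Dphi φ t x) x :=
  ((h.2.2.2.1 t).differentiable one_ne_zero x).hasFDerivAt

lemma IsFlowOf.Dphi_add (h : IsFlowOf X φ) (s t : ℝ) (x v : V3) :
    Dphi φ (s + t) x v = Dphi φ s (φ t x) (Dphi φ t x v) := by
  have h1 := (h.hasFDerivAt s (φ t x)).comp x (h.hasFDerivAt t x)
  have h2 : φ s ∘ φ t = φ (s + t) := funext fun y => (h.2.2.1 s t y).symm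
  rw [h2] at h1
  rw [(h.hasFDerivAt (s + t) x).unique h1]
  rfl

lemma IsFlowOf.Dphi_zero (h : IsFlowOf X φ) (x v : V3) : Dphi φ 0 x v = v := by
  have h2 : φ 0 = id := funext h.2.1
  simp [Dphi, h2]

lemma IsFlowOf.map_neg_map (h : IsFlowOf X φ) (t : ℝ) (x : V3) : φ t (φ (-t) x) = x := by
  rw [← h.2.2.1, add_neg_cancel, h.2.1]

lemma IsFlowOf.Dphi_Dphi_neg (h : IsFlowOf X φ) (t : ℝ) (x v : V3) :
    Dphi φ t (φ (-t) x) (Dphi φ (-t) x v) = v := by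
  rw [← h.Dphi_add, add_neg_cancel, h.Dphi_zero]

lemma IsFlowOf.Dphi_neg_Dphi (h : IsFlowOf X φ) (t : ℝ) (x v : V3) :
    Dphi φ (-t) (φ t x) (Dphi φ t x v) = v := by
  rw [← h.Dphi_add, neg_add_cancel, h.Dphi_zero]

lemma IsFlowOf.Dphi_field (h : IsFlowOf X φ) (t : ℝ) (x : V3) :
    Dphi φ t x (X x) = X (φ t x) := by
  have h1 := h.2.2.2.2 x 0
  rw [h.2.1] at h1
  have h2 : HasFDerivAt (φ t) (Dphi φ t x) (φ 0 x) := by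
    rw [h.2.1]; exact h.hasFDerivAt t x
  have h3 := h2.comp_hasDerivAt (0 : ℝ) h1
  have h4 := h.2.2.2.2 (φ t x) 0
  rw [h.2.1] at h4
  refine h3.unique (h4.congr_of_eventuallyEq (Eventually.of_forall fun s => ?_))
  simp only [Function.comp_apply]
  rw [← h.2.2.1, ← h.2.2.1, add_comm]

lemma IsFlowOf.continuous_Dphi (h : IsFlowOf X φ) (t : ℝ) :
    Continuous fun q : V3 × V3 => Dphi φ t q.1 q.2 :=
  (((h.2.2.2.1 t).continuous_fderiv one_ne_zero).comp continuous_fst).clm_apply continuous_snd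

end FlowBasics

section FieldBounds

variable {X : V3 → V3} {φ : ℝ → V3 → V3}

/-- The set of times at which `φ t` is `η`-close to a linear map on a closed ball is closed. -/
lemma IsFlowOf.isClosed_approximatesLinear (h : IsFlowOf X φ) (A : V3 →L[ℝ] V3) (S : Set V3)
    (η : ℝ) :
    IsClosed {t : ℝ | ∀ x ∈ S, ∀ y ∈ S, ‖φ t x - φ t y - A (x - y)‖ ≤ η * ‖x - y‖} := by
  simp only [Set.ofPred_forall]
  refine isClosed_iInter fun x => isClosed_iInter fun _ => isClosed_iInter fun y =>
    isClosed_iInter fun _ => ?_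
  have hc : ∀ z, Continuous fun t => φ t z := fun z =>
    h.1.comp (continuous_id.prodMk continuous_const)
  exact isClosed_le (((hc x).sub (hc y)).sub continuous_const).norm continuous_const

/-- Baire category: on a neighbourhood of `x₀` and an interval of times, the flow is uniformly
close to a single injective linear map. -/
lemma IsFlowOf.exists_approximatesLinear (h : IsFlowOf X φ) (x₀ : V3) :
    ∃ (A : V3 →L[ℝ] V3) (N r : ℝ), 0 < N ∧ 0 < r ∧ (∀ v, ‖v‖ ≤ N * ‖A v‖) ∧
      (interior {t : ℝ | ∀ x ∈ closedBall x₀ r, ∀ y ∈ closedBall x₀ r,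
        ‖φ t x - φ t y - A (x - y)‖ ≤ (8 * N)⁻¹ * ‖x - y‖}).Nonempty := by
  let D := TopologicalSpace.denseSeq (V3 →L[ℝ] V3)
  let f : ℕ × ℕ × ℕ → Set ℝ := fun i =>
    {t : ℝ | (∀ v, ‖v‖ ≤ ((i.2.1 : ℝ) + 1) * ‖D i.1 v‖) ∧
      ∀ x ∈ closedBall x₀ ((i.2.2 : ℝ) + 1)⁻¹, ∀ y ∈ closedBall x₀ ((i.2.2 : ℝ) + 1)⁻¹,
        ‖φ t x - φ t y - D i.1 (x - y)‖ ≤ (8 * ((i.2.1 : ℝ) + 1))⁻¹ * ‖x - y‖}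
  have hclosed : ∀ i, IsClosed (f i) := fun i =>
    isClosed_const.and (h.isClosed_approximatesLinear _ _ _)
  have hcover : ⋃ i, f i = univ := by
    refine eq_univ_of_forall fun t => mem_iUnion.2 ?_
    set A := Dphi φ t x₀ with hA
    set B := Dphi φ (-t) (φ t x₀) with hB
    obtain ⟨N, hN⟩ := exists_nat_ge (2 * ‖B‖)
    have hAB : ∀ v, ‖v‖ ≤ ‖B‖ * ‖A v‖ := fun v => by
      have := B.le_opNorm (A v)
      rwa [hA, hB, h.Dphi_neg_Dphi] at this
    have hN1 : (0 : ℝ) < N + 1 := by positivity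
    set η : ℝ := (16 * ((N : ℝ) + 1))⁻¹ with hη
    have hηpos : 0 < η := by positivity
    have hη2 : (8 * ((N : ℝ) + 1))⁻¹ = η + η := by rw [hη]; field_simp; norm_num
    have hηN : ((N : ℝ) + 1) * η = 1 / 16 := by rw [hη]; field_simp
    obtain ⟨k, hk⟩ := (TopologicalSpace.denseRange_denseSeq (V3 →L[ℝ] V3)).exists_dist_lt A hηpos
    change dist A (D k) < η at hk
    rw [dist_eq_norm] at hk
    have hkv : ∀ v, ‖A v - D k v‖ ≤ η * ‖v‖ := fun v =>
      ((A - D k).le_opNorm v).trans (mul_le_mul_of_nonneg_right hk.le (norm_nonneg _))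
    have hstrict : HasStrictFDerivAt (φ t) A x₀ :=
      (h.2.2.2.1 t).contDiffAt.hasStrictFDerivAt one_ne_zero
    have hev := hstrict.isLittleO.def hηpos
    obtain ⟨ε, hε, hball⟩ := Metric.eventually_nhds_iff.1 hev
    obtain ⟨m, hm⟩ := exists_nat_one_div_lt hε
    rw [one_div] at hm
    refine ⟨(k, N, m), fun v => ?_, fun x hx y hy => ?_⟩
    · have h1 := hAB v
      have h2 := hkv v
      have h3 : ‖A v‖ ≤ ‖D k v‖ + η * ‖v‖ := by
        have := norm_add_le (D k v) (A v - D k v)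
        rw [add_sub_cancel] at this
        linarith
      have h4 : ‖B‖ * ‖A v‖ ≤ ((N : ℝ) + 1) / 2 * (‖D k v‖ + η * ‖v‖) :=
        mul_le_mul (by linarith) h3 (norm_nonneg _) (by positivity)
      have h5 : ((N : ℝ) + 1) / 2 * (η * ‖v‖) = 1 / 32 * ‖v‖ := by
        rw [← mul_assoc, div_mul_eq_mul_div, hηN]; ring
      have h6 := norm_nonneg v
      change ‖v‖ ≤ ((N : ℝ) + 1) * ‖D k v‖
      nlinarith
    · have hxy : dist (x, y) (x₀, x₀) < ε := by
        rw [Prod.dist_eq]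
        exact max_lt (lt_of_le_of_lt hx hm) (lt_of_le_of_lt hy hm)
      have h1 := hball hxy
      have h2 := hkv (x - y)
      change ‖φ t x - φ t y - D k (x - y)‖ ≤ (8 * ((N : ℝ) + 1))⁻¹ * ‖x - y‖
      rw [hη2, add_mul]
      calc ‖φ t x - φ t y - D k (x - y)‖
          = ‖(φ t x - φ t y - A (x - y)) + (A (x - y) - D k (x - y))‖ := by
            rw [sub_add_sub_cancel]
        _ ≤ _ := (norm_add_le _ _).trans (add_le_add h1 h2)
  obtain ⟨⟨k, N, m⟩, hi⟩ := nonempty_interior_of_iUnion_of_closed hclosed hcover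
  obtain ⟨t, ht⟩ := hi
  refine ⟨D k, N + 1, ((m : ℝ) + 1)⁻¹, by positivity, by positivity,
    (interior_subset ht).1, t, interior_mono (fun s hs => hs.2) ht⟩

/-- `Dphi φ s x` is close to the identity for small `s`, locally uniformly in `x`. -/
lemma IsFlowOf.eventually_norm_Dphi_sub_le (h : IsFlowOf X φ) (x₀ : V3) :
    ∃ δ > 0, ∃ U ∈ 𝓝 x₀, ∀ s : ℝ, |s| < δ → ∀ x ∈ U, ∀ v,
      ‖Dphi φ s x v - v‖ ≤ 1 / 2 * ‖v‖ := by
  obtain ⟨A, N, r, hN, hr, hA, t₀, ht₀⟩ := h.exists_approximatesLinear x₀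
  obtain ⟨δ₁, hδ₁, hint⟩ := Metric.mem_nhds_iff.1 (mem_interior_iff_mem_nhds.1 ht₀)
  have hD : ∀ t ∈ ball t₀ δ₁, ∀ x ∈ ball x₀ r, ∀ v,
      ‖Dphi φ t x v - A v‖ ≤ (8 * N)⁻¹ * ‖v‖ := by
    intro t ht x hx v
    have hder : HasFDerivAt (fun y => φ t y - A y) (Dphi φ t x - A) x :=
      (h.hasFDerivAt t x).sub A.hasFDerivAt
    have hle : ‖Dphi φ t x - A‖ ≤ (8 * N)⁻¹ := by
      refine hder.le_of_lip' (by positivity) ?_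
      filter_upwards [isOpen_ball.mem_nhds hx] with y hy
      have := hint ht y (ball_subset_closedBall hy) x (ball_subset_closedBall hx)
      rwa [map_sub, sub_sub_sub_comm] at this
    exact ((Dphi φ t x - A).le_opNorm v).trans
      (mul_le_mul_of_nonneg_right hle (norm_nonneg _))
  have hcont : ContinuousAt (fun q : ℝ × V3 => φ q.1 q.2) (0, x₀) := h.1.continuousAt
  have hnhds : (fun q : ℝ × V3 => φ q.1 q.2) ⁻¹' ball x₀ r ∈ 𝓝 ((0 : ℝ), x₀) :=
    hcont.preimage_mem_nhds (by rw [h.2.1]; exact ball_mem_nhds _ hr)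
  obtain ⟨S, hS, U, hU, hSU⟩ := mem_nhds_prod_iff.1 hnhds
  obtain ⟨δ₂, hδ₂, hS2⟩ := Metric.mem_nhds_iff.1 hS
  refine ⟨min δ₁ δ₂, lt_min hδ₁ hδ₂, U ∩ ball x₀ r, inter_mem hU (ball_mem_nhds _ hr), ?_⟩
  rintro s hs x ⟨hxU, hxr⟩ v
  have hsS : s ∈ S := hS2 (by simpa using hs.trans_le (min_le_right _ _))
  have hmem : φ s x ∈ ball x₀ r := hSU (mk_mem_prod hsS hxU)
  have h1 := hD t₀ (mem_ball_self hδ₁) (φ s x) hmem (Dphi φ s x v)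
  have h2 := hD (t₀ + s) (by simpa using hs.trans_le (min_le_left _ _)) x hxr v
  rw [h.Dphi_add] at h2
  have h3 := hA (Dphi φ s x v - v)
  have h4 : ‖A (Dphi φ s x v - v)‖ ≤ (8 * N)⁻¹ * ‖Dphi φ s x v‖ + (8 * N)⁻¹ * ‖v‖ := by
    rw [map_sub]
    calc _ = ‖(Dphi φ t₀ (φ s x) (Dphi φ s x v) - A v)
          - (Dphi φ t₀ (φ s x) (Dphi φ s x v) - A (Dphi φ s x v))‖ := by congr 1; abel
      _ ≤ _ := (norm_sub_le _ _).trans (by linarith)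
  have h5 : ‖Dphi φ s x v‖ ≤ ‖Dphi φ s x v - v‖ + ‖v‖ := by
    simpa using norm_add_le (Dphi φ s x v - v) v
  have h6 : N * ‖A (Dphi φ s x v - v)‖ ≤ 1 / 8 * (‖Dphi φ s x v‖ + ‖v‖) := by
    have := mul_le_mul_of_nonneg_left h4 hN.le
    have e : N * ((8 * N)⁻¹ * ‖Dphi φ s x v‖ + (8 * N)⁻¹ * ‖v‖)
        = 1 / 8 * (‖Dphi φ s x v‖ + ‖v‖) := by field_simp
    linarith
  linarith [norm_nonneg v]

/-- Locally, `‖X‖` is comparable with the displacement of a fixed small time. -/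
lemma IsFlowOf.exists_displacement_comparison (h : IsFlowOf X φ) (x₀ : V3) :
    ∃ s > 0, ∃ U ∈ 𝓝 x₀, ∀ x ∈ U,
      s / 2 * ‖X x‖ ≤ ‖φ s x - x‖ ∧ ‖φ s x - x‖ ≤ 2 * s * ‖X x‖ := by
  obtain ⟨δ, hδ, U, hU, hclose⟩ := h.eventually_norm_Dphi_sub_le x₀
  refine ⟨δ / 2, by positivity, U, hU, fun x hx => ?_⟩
  have hder : ∀ u ∈ Icc (0 : ℝ) (δ / 2), HasDerivWithinAt (fun u => φ u x - u • X x)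
      (X (φ u x) - X x) (Icc 0 (δ / 2)) u := fun u _ => by
    have := (h.2.2.2.2 x u).sub ((hasDerivAt_id u).smul_const (X x))
    rw [one_smul] at this
    exact this.hasDerivWithinAt
  have hbound : ∀ u ∈ Icc (0 : ℝ) (δ / 2), ‖X (φ u x) - X x‖ ≤ 1 / 2 * ‖X x‖ := by
    intro u hu
    rw [← h.Dphi_field]
    exact hclose u (by rw [abs_of_nonneg hu.1]; linarith [hu.2]) x hx _
  have hmv := (convex_Icc (0 : ℝ) (δ / 2)).norm_image_sub_le_of_norm_hasDerivWithin_le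
    hder hbound (left_mem_Icc.2 (by positivity)) (right_mem_Icc.2 (by positivity))
  rw [h.2.1, zero_smul, sub_zero, sub_zero, Real.norm_of_nonneg (by positivity : 0 ≤ δ / 2)] at hmv
  have hn : ‖(δ / 2) • X x‖ = δ / 2 * ‖X x‖ := by
    rw [norm_smul, Real.norm_of_nonneg (by positivity)]
  have hnn : 0 ≤ δ * ‖X x‖ := by positivity
  have e : φ (δ / 2) x - (δ / 2) • X x - x = (φ (δ / 2) x - x) - (δ / 2) • X x := by abel
  rw [e] at hmv
  have h1 := norm_sub_norm_le ((δ / 2) • X x) (φ (δ / 2) x - x)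
  rw [norm_sub_rev ((δ / 2) • X x)] at h1
  have h2 := norm_sub_norm_le (φ (δ / 2) x - x) ((δ / 2) • X x)
  constructor <;> nlinarith

lemma IsFlowOf.exists_field_bounds (h : IsFlowOf X φ) {S : Set V3} (hS : IsCompact S)
    (hX : ∀ x ∈ S, X x ≠ 0) :
    ∃ m M : ℝ, 0 < m ∧ 0 < M ∧ ∀ x ∈ S, m ≤ ‖X x‖ ∧ ‖X x‖ ≤ M := by
  refine hS.induction_on (p := fun S => ∃ m M : ℝ, 0 < m ∧ 0 < M ∧ ∀ x ∈ S, m ≤ ‖X x‖ ∧ ‖X x‖ ≤ M)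
    ⟨1, 1, one_pos, one_pos, by simp⟩ ?_ ?_ ?_
  · rintro s t hst ⟨m, M, hm, hM, hb⟩
    exact ⟨m, M, hm, hM, fun x hx => hb x (hst hx)⟩
  · rintro s t ⟨m, M, hm, hM, hb⟩ ⟨m', M', hm', hM', hb'⟩
    refine ⟨min m m', max M M', lt_min hm hm', lt_max_of_lt_left hM, ?_⟩
    rintro x (hx | hx)
    · exact ⟨(min_le_left _ _).trans (hb x hx).1, (hb x hx).2.trans (le_max_left _ _)⟩
    · exact ⟨(min_le_right _ _).trans (hb' x hx).1, (hb' x hx).2.trans (le_max_right _ _)⟩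
  · intro x hx
    obtain ⟨s, hs, U, hU, hcmp⟩ := h.exists_displacement_comparison x
    have hd : 0 < ‖φ s x - x‖ :=
      lt_of_lt_of_le (mul_pos (by positivity) (norm_pos_iff.2 (hX x hx)))
        (hcmp x (mem_of_mem_nhds hU)).1
    have hc : Continuous fun y => ‖φ s y - y‖ := ((h.2.2.2.1 s).continuous.sub continuous_id).norm
    set d := ‖φ s x - x‖ with hd_def
    refine ⟨U ∩ {y | d / 2 < ‖φ s y - y‖} ∩ {y | ‖φ s y - y‖ < 2 * d},
      mem_nhdsWithin_of_mem_nhds (inter_mem (inter_mem hU ?_) ?_),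
      d / (4 * s), 4 * d / s, by positivity, by positivity, ?_⟩
    · exact (isOpen_lt continuous_const hc).mem_nhds (by simp only [mem_ofPred_eq]; linarith)
    · exact (isOpen_lt hc continuous_const).mem_nhds (by simp only [mem_ofPred_eq]; linarith)
    · rintro y ⟨⟨hyU, hy1⟩, hy2⟩
      simp only [mem_ofPred_eq] at hy1 hy2
      obtain ⟨h1, h2⟩ := hcmp y hyU
      constructor
      · rw [div_le_iff₀ (by positivity)]; nlinarith
      · rw [le_div_iff₀ hs]; nlinarith

end FieldBounds

section UnstableDirection

variable {X : V3 → V3} {φ : ℝ → V3 → V3}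

lemma IsFlowOf.Dphi_injective (h : IsFlowOf X φ) (t : ℝ) (x : V3) :
    Function.Injective (Dphi φ t x) := fun v w hvw => by
  rw [← h.Dphi_neg_Dphi t x v, hvw, h.Dphi_neg_Dphi]

lemma FlowInv.mem {S : Set V3} (hS : FlowInv φ S) (t : ℝ) {x : V3} (hx : x ∈ S) : φ t x ∈ S := by
  rw [← hS t]; exact mem_image_of_mem _ hx

lemma IsFlowOf.exists_Dphi_bound (h : IsFlowOf X φ) {S : Set V3} (hS : IsCompact S) (t : ℝ) :
    ∃ D : ℝ, 0 ≤ D ∧ ∀ x ∈ S, ∀ v, ‖Dphi φ t x v‖ ≤ D * ‖v‖ := by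
  obtain ⟨D, hD⟩ := hS.exists_bound_of_continuousOn
    ((h.2.2.2.1 t).continuous_fderiv one_ne_zero).continuousOn
  refine ⟨max D 0, le_max_right _ _, fun x hx v => ?_⟩
  exact ((Dphi φ t x).le_opNorm v).trans
    (mul_le_mul_of_nonneg_right ((hD x hx).trans (le_max_left _ _)) (norm_nonneg _))

/-- A vector field bounded on backward orbits lies in the dominating bundle. -/
lemma IsFlowOf.field_mem_of_dominated (h : IsFlowOf X φ) {Es Ec : V3 → Submodule ℝ V3}
    {S : Set V3} {K lam M : ℝ} (hS : FlowInv φ S) (hK : 1 ≤ K) (hlam : 0 < lam)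
    (hsup : ∀ x ∈ S, Es x ⊔ Ec x = ⊤)
    (hEs : ∀ x ∈ S, ∀ t : ℝ, (Es x).map (Dphi φ t x : V3 →ₗ[ℝ] V3) = Es (φ t x))
    (hEc : ∀ x ∈ S, ∀ t : ℝ, (Ec x).map (Dphi φ t x : V3 →ₗ[ℝ] V3) = Ec (φ t x))
    (hcontr : ∀ x ∈ S, ∀ t ≥ 0, ∀ v ∈ Es x,
      ‖Dphi φ t x v‖ ≤ K * Real.exp (-lam * t) * ‖v‖)
    (hdom : ∀ x ∈ S, ∀ t ≥ 0, ∀ v ∈ Es x, ∀ w ∈ Ec x,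
      ‖Dphi φ t x v‖ * ‖w‖ ≤ K * Real.exp (-lam * t) * (‖v‖ * ‖Dphi φ t x w‖))
    (hM : ∀ x ∈ S, ‖X x‖ ≤ M) {x : V3} (hx : x ∈ S) : X x ∈ Ec x := by
  obtain ⟨v, hv, w, hw, hvw⟩ := Submodule.mem_sup.1
    (show X x ∈ Es x ⊔ Ec x by rw [hsup x hx]; trivial)
  suffices hv0 : v = 0 by rw [← hvw, hv0, zero_add]; exact hw
  by_contra hv0
  have hvpos : 0 < ‖v‖ := norm_pos_iff.2 hv0
  have hM0 : 0 ≤ M := (norm_nonneg _).trans (hM x hx)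
  have hlim : Tendsto (fun t : ℝ => K * Real.exp (-lam * t) * (‖w‖ + 2 * M + 1)) atTop (𝓝 0) := by
    have : Tendsto (fun t : ℝ => Real.exp (-lam * t)) atTop (𝓝 0) :=
      Real.tendsto_exp_atBot.comp (tendsto_id.const_mul_atTop_of_neg (by linarith))
    simpa using (this.const_mul K).mul_const (‖w‖ + 2 * M + 1)
  obtain ⟨t, ht, ht0⟩ := ((hlim.eventually_lt_const (half_pos hvpos)).and
    (eventually_ge_atTop 0)).exists
  have hy := hS.mem (-t) hx
  have hv' : Dphi φ (-t) x v ∈ Es (φ (-t) x) := by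
    rw [← hEs x hx]; exact Submodule.mem_map_of_mem hv
  have hw' : Dphi φ (-t) x w ∈ Ec (φ (-t) x) := by
    rw [← hEc x hx]; exact Submodule.mem_map_of_mem hw
  have h1 := hcontr _ hy t ht0 _ hv'
  have h2 := hdom _ hy t ht0 _ hv' _ hw'
  rw [h.Dphi_Dphi_neg] at h1 h2
  rw [h.Dphi_Dphi_neg] at h2
  have h3 : ‖Dphi φ (-t) x v‖ ≤ M + ‖Dphi φ (-t) x w‖ := by
    have e : Dphi φ (-t) x v = X (φ (-t) x) - Dphi φ (-t) x w := by
      rw [← h.Dphi_field, ← hvw, map_add, add_sub_cancel_right]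
    rw [e]
    exact (norm_sub_le _ _).trans (by linarith [hM _ hy])
  set a := ‖Dphi φ (-t) x v‖
  set b := ‖Dphi φ (-t) x w‖
  set k := K * Real.exp (-lam * t)
  have hk : 0 < k := by positivity
  have ha : 0 ≤ a := norm_nonneg _
  have hkw : k * ‖w‖ < ‖v‖ / 2 := by nlinarith [norm_nonneg w]
  have h4 : ‖v‖ * a ≤ ‖v‖ * (2 * M) := by nlinarith
  have h5 : a ≤ 2 * M := le_of_mul_le_mul_left h4 hvpos
  nlinarith [norm_nonneg w]

/-- Vectors of `E x` contracted by the backward flow (at integer times). -/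
def backwardStable (φ : ℝ → V3 → V3) (E : V3 → Submodule ℝ V3) (x : V3) : Submodule ℝ V3 where
  carrier := {w | w ∈ E x ∧ Tendsto (fun n : ℕ => Dphi φ (-n) x w) atTop (𝓝 0)}
  add_mem' := by
    rintro a b ⟨ha, ha'⟩ ⟨hb, hb'⟩
    exact ⟨add_mem ha hb, by simpa using ha'.add hb'⟩
  zero_mem' := ⟨zero_mem _, by simp⟩
  smul_mem' := by
    rintro c a ⟨ha, ha'⟩
    exact ⟨Submodule.smul_mem _ c ha, by simpa using ha'.const_smul c⟩

lemma mem_backwardStable {E : V3 → Submodule ℝ V3} {x w : V3} :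
    w ∈ backwardStable φ E x ↔
      w ∈ E x ∧ Tendsto (fun n : ℕ => Dphi φ (-n) x w) atTop (𝓝 0) := Iff.rfl

lemma IsFlowOf.map_mem_backwardStable (h : IsFlowOf X φ) {E : V3 → Submodule ℝ V3}
    {S : Set V3} (hSc : IsCompact S) (hS : FlowInv φ S)
    (hE : ∀ x ∈ S, ∀ t : ℝ, (E x).map (Dphi φ t x : V3 →ₗ[ℝ] V3) = E (φ t x))
    {x : V3} (hx : x ∈ S) (t : ℝ) {w : V3} (hw : w ∈ backwardStable φ E x) :
    Dphi φ t x w ∈ backwardStable φ E (φ t x) := by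
  refine ⟨by rw [← hE x hx]; exact Submodule.mem_map_of_mem hw.1, ?_⟩
  obtain ⟨D, hD, hb⟩ := h.exists_Dphi_bound hSc t
  have hlim : Tendsto (fun n : ℕ => D * ‖Dphi φ (-n) x w‖) atTop (𝓝 0) := by
    simpa using hw.2.norm.const_mul D
  refine squeeze_zero_norm (fun n => ?_) hlim
  rw [← h.Dphi_add, add_comm, h.Dphi_add]
  exact hb _ (hS.mem _ hx) _

lemma IsFlowOf.map_backwardStable (h : IsFlowOf X φ) {E : V3 → Submodule ℝ V3}
    {S : Set V3} (hSc : IsCompact S) (hS : FlowInv φ S)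
    (hE : ∀ x ∈ S, ∀ t : ℝ, (E x).map (Dphi φ t x : V3 →ₗ[ℝ] V3) = E (φ t x))
    {x : V3} (hx : x ∈ S) (t : ℝ) :
    (backwardStable φ E x).map (Dphi φ t x : V3 →ₗ[ℝ] V3) = backwardStable φ E (φ t x) := by
  refine le_antisymm ?_ fun w hw => ?_
  · rintro _ ⟨w, hw, rfl⟩
    exact h.map_mem_backwardStable hSc hS hE hx t hw
  · have := h.map_mem_backwardStable hSc hS hE (hS.mem t hx) (-t) hw
    rw [← h.2.2.1, neg_add_cancel, h.2.1] at this
    refine ⟨_, this, ?_⟩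
    change Dphi φ t x _ = w
    have e := h.Dphi_Dphi_neg t (φ t x) w
    rwa [← h.2.2.1 (-t), neg_add_cancel, h.2.1] at e

variable {Ec : V3 → Submodule ℝ V3} {S : Set V3} {K lam m M : ℝ}

lemma IsFlowOf.field_crossProduct_backward_le (h : IsFlowOf X φ) (hS : FlowInv φ S) (hK : 1 ≤ K)
    (hEc : ∀ x ∈ S, ∀ t : ℝ, (Ec x).map (Dphi φ t x : V3 →ₗ[ℝ] V3) = Ec (φ t x))
    (hvol : ∀ x ∈ S, ∀ t ≥ 0, ∀ u ∈ Ec x, ∀ w ∈ Ec x,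
      K⁻¹ * Real.exp (lam * t) * ‖crossProduct u w‖ ≤
        ‖crossProduct (Dphi φ t x u) (Dphi φ t x w)‖)
    (hXc : ∀ x ∈ S, X x ∈ Ec x) {x : V3} (hx : x ∈ S) {t : ℝ} (ht : 0 ≤ t) {u : V3}
    (hu : u ∈ Ec x) :
    ‖crossProduct (Dphi φ (-t) x u) (X (φ (-t) x))‖ ≤
      K * Real.exp (-lam * t) * ‖crossProduct u (X x)‖ := by
  have hu' : Dphi φ (-t) x u ∈ Ec (φ (-t) x) := by
    rw [← hEc x hx]; exact Submodule.mem_map_of_mem hu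
  have := hvol _ (hS.mem (-t) hx) t ht _ hu' _ (hXc _ (hS.mem (-t) hx))
  rw [h.Dphi_Dphi_neg, h.Dphi_field, h.map_neg_map] at this
  have hK0 : 0 < K := by linarith
  calc _ = K * Real.exp (-lam * t) * (K⁻¹ * Real.exp (lam * t) *
        ‖crossProduct (Dphi φ (-t) x u) (X (φ (-t) x))‖) := by
          rw [neg_mul, Real.exp_neg]; field_simp
    _ ≤ _ := mul_le_mul_of_nonneg_left this (by positivity)

/-- Existence of a backward contracted vector transverse to the field inside the central bundle,
obtained by correcting an arbitrary transverse vector along the field. -/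
lemma IsFlowOf.exists_correction (h : IsFlowOf X φ) (hSc : IsCompact S) (hS : FlowInv φ S)
    (hK : 1 ≤ K) (hlam : 0 < lam) (hm : 0 < m)
    (hEc : ∀ x ∈ S, ∀ t : ℝ, (Ec x).map (Dphi φ t x : V3 →ₗ[ℝ] V3) = Ec (φ t x))
    (hvol : ∀ x ∈ S, ∀ t ≥ 0, ∀ u ∈ Ec x, ∀ w ∈ Ec x,
      K⁻¹ * Real.exp (lam * t) * ‖crossProduct u w‖ ≤
        ‖crossProduct (Dphi φ t x u) (Dphi φ t x w)‖)
    (hXc : ∀ x ∈ S, X x ∈ Ec x) (hX : ∀ x ∈ S, m ≤ ‖X x‖ ∧ ‖X x‖ ≤ M) :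
    ∃ C : ℝ, 0 ≤ C ∧ ∀ x ∈ S, ∀ u ∈ Ec x, ∃ c : ℝ,
      u - c • X x ∈ backwardStable φ Ec x ∧
      ‖u - c • X x‖ ≤ C * ‖crossProduct (u - c • X x) (X x)‖ := by
  obtain ⟨D, hD0, hD⟩ := h.exists_Dphi_bound hSc (-1)
  rcases S.eq_empty_or_nonempty with rfl | ⟨x', hx'⟩
  · exact ⟨0, le_rfl, by simp⟩
  have hM : 0 < M := hm.trans_le ((hX x' hx').1.trans (hX x' hx').2)
  set r := Real.exp (-lam) with hr
  have hr0 : 0 < r := Real.exp_pos _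
  have hr1 : r < 1 := by rw [hr]; simpa using hlam
  have hr1' : 0 < 1 - r := by linarith
  refine ⟨K / m + (D + 1) * K / m ^ 2 / (1 - r) * M, by positivity, fun x hx u hu => ?_⟩
  set a := ‖crossProduct u (X x)‖ with ha
  have ha0 : 0 ≤ a := norm_nonneg _
  have hc : ∀ n : ℕ, ∃ c : ℝ,
      ‖Dphi φ (-n) x u - c • X (φ (-n) x)‖ ≤ K * r ^ n * a / m := by
    intro n
    obtain ⟨c, hc⟩ := exists_norm_sub_smul_mul_norm_le (Dphi φ (-n) x u) (X (φ (-n) x))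
    refine ⟨c, ?_⟩
    rw [le_div_iff₀ hm]
    have h1 := h.field_crossProduct_backward_le hS hK hEc hvol hXc hx (Nat.cast_nonneg n) hu
    have e : Real.exp (-lam * n) = r ^ n := by rw [hr, ← Real.exp_nat_mul, mul_comm]
    rw [e] at h1
    exact (mul_le_mul_of_nonneg_left (hX _ (hS.mem _ hx)).1 (norm_nonneg _)).trans (hc.trans h1)
  choose c hc using hc
  have hstep : ∀ n, dist (c n) (c (n + 1)) ≤ (D + 1) * K / m ^ 2 * a * r ^ n := by
    intro n
    have hy := hS.mem (-(n + 1 : ℕ)) hx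
    have h1 : ‖Dphi φ (-(n + 1 : ℕ)) x u - c n • X (φ (-(n + 1 : ℕ)) x)‖
        ≤ D * (K * r ^ n * a / m) := by
      have e : (-((n + 1 : ℕ) : ℝ)) = -1 + -n := by push_cast; ring
      rw [e, h.Dphi_add, h.2.2.1, ← h.Dphi_field, ← map_smul, ← map_sub]
      exact (hD _ (hS.mem _ hx) _).trans (mul_le_mul_of_nonneg_left (hc n) hD0)
    have h2 : ‖Dphi φ (-(n + 1 : ℕ)) x u - c (n + 1) • X (φ (-(n + 1 : ℕ)) x)‖
        ≤ K * r ^ n * a / m := by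
      refine (hc (n + 1)).trans ?_
      have := pow_le_pow_of_le_one hr0.le hr1.le (Nat.le_succ n)
      gcongr
    have h3 : dist (c n) (c (n + 1)) * m ≤ (D + 1) * (K * r ^ n * a / m) := by
      calc dist (c n) (c (n + 1)) * m
          ≤ dist (c n) (c (n + 1)) * ‖X (φ (-(n + 1 : ℕ)) x)‖ :=
            mul_le_mul_of_nonneg_left (hX _ hy).1 dist_nonneg
        _ = ‖(Dphi φ (-(n + 1 : ℕ)) x u - c (n + 1) • X (φ (-(n + 1 : ℕ)) x))
              - (Dphi φ (-(n + 1 : ℕ)) x u - c n • X (φ (-(n + 1 : ℕ)) x))‖ := by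
            rw [Real.dist_eq, ← Real.norm_eq_abs, ← norm_smul, sub_smul]; congr 1; abel
        _ ≤ _ := (norm_sub_le _ _).trans (by linarith)
    rw [← le_div_iff₀ hm] at h3
    refine h3.trans (le_of_eq ?_)
    field_simp
  obtain ⟨c', hc'⟩ := cauchySeq_tendsto_of_complete (cauchySeq_of_le_geometric r _ hr1 hstep)
  have hdist := dist_le_of_le_geometric_of_tendsto₀ r _ hr1 hstep hc'
  have hcross : crossProduct (u - c' • X x) (X x) = crossProduct u (X x) := by
    simp [cross_self]
  refine ⟨c', ⟨sub_mem hu (Submodule.smul_mem _ _ (hXc x hx)), ?_⟩, ?_⟩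
  · have hlim : Tendsto (fun n : ℕ => K * r ^ n * a / m + ‖c n - c'‖ * M) atTop (𝓝 0) := by
      have h1 := tendsto_pow_atTop_nhds_zero_of_lt_one hr0.le hr1
      have h2 : Tendsto (fun n => ‖c n - c'‖) atTop (𝓝 0) :=
        tendsto_iff_norm_sub_tendsto_zero.1 hc'
      simpa using (((h1.const_mul K).mul_const a).div_const m).add (h2.mul_const M)
    refine squeeze_zero_norm (fun n => ?_) hlim
    rw [map_sub, map_smul, h.Dphi_field]
    calc _ = ‖(Dphi φ (-n) x u - c n • X (φ (-n) x)) + (c n - c') • X (φ (-n) x)‖ := by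
          rw [sub_smul, sub_add_sub_cancel]
      _ ≤ _ := (norm_add_le _ _).trans (add_le_add (hc n) ?_)
    rw [norm_smul]
    exact mul_le_mul_of_nonneg_left (hX _ (hS.mem _ hx)).2 (norm_nonneg _)
  · rw [hcross]
    have h0 := hc 0
    simp only [Nat.cast_zero, neg_zero, h.Dphi_zero, h.2.1, pow_zero, mul_one] at h0
    calc _ = ‖(u - c 0 • X x) + (c 0 - c') • X x‖ := by rw [sub_smul, sub_add_sub_cancel]
      _ ≤ K * a / m + (D + 1) * K / m ^ 2 * a / (1 - r) * M := by
        refine (norm_add_le _ _).trans (add_le_add h0 ?_)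
        rw [norm_smul, ← dist_eq_norm]
        exact mul_le_mul hdist (hX x hx).2 (norm_nonneg _) (dist_nonneg.trans hdist)
      _ = _ := by rw [← ha]; ring

end UnstableDirection

theorem stmt12 (X : V3 → V3) (φ : ℝ → V3 → V3) (Λ : Set V3)
    (hflow : IsFlowOf X φ) (hsh : SingHyp X φ Λ)
    (hdense : Λ ⊆ closure (PerSet X φ Λ))
    (Hs : Set V3) (hsub : Hs ⊆ Λ) (hcomp : IsCompact Hs) (hinv : FlowInv φ Hs)
    (hnosing : ∀ x ∈ Hs, X x ≠ 0) :
    ∃ (Fs Fu : V3 → Submodule ℝ V3) (C μ : ℝ),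
      1 ≤ C ∧ 0 < μ ∧
      (∀ x ∈ Hs, Module.finrank ℝ (Fs x) = 1) ∧
      (∀ x ∈ Hs, Module.finrank ℝ (Fu x) = 1) ∧
      IsClosed {q : V3 × V3 | q.1 ∈ Hs ∧ q.2 ∈ Fs q.1} ∧
      IsClosed {q : V3 × V3 | q.1 ∈ Hs ∧ q.2 ∈ Fu q.1} ∧
      (∀ x ∈ Hs, Fs x ⊔ (Submodule.span ℝ {X x} ⊔ Fu x) = ⊤) ∧
      (∀ x ∈ Hs, Fs x ⊓ (Submodule.span ℝ {X x} ⊔ Fu x) = ⊥) ∧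
      (∀ x ∈ Hs, Submodule.span ℝ {X x} ⊓ Fu x = ⊥) ∧
      (∀ x ∈ Hs, ∀ t : ℝ, (Fs x).map (Dphi φ t x : V3 →ₗ[ℝ] V3) = Fs (φ t x)) ∧
      (∀ x ∈ Hs, ∀ t : ℝ, (Fu x).map (Dphi φ t x : V3 →ₗ[ℝ] V3) = Fu (φ t x)) ∧
      (∀ x ∈ Hs, ∀ t ≥ 0, ∀ v ∈ Fs x,
        ‖Dphi φ t x v‖ ≤ C * Real.exp (-μ * t) * ‖v‖) ∧
      (∀ x ∈ Hs, ∀ t ≥ 0, ∀ v ∈ Fu x,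
        ‖Dphi φ (-t) x v‖ ≤ C * Real.exp (-μ * t) * ‖v‖) := by
  obtain ⟨Es, Ec, K, lam, hK, hlam, hEs1, hEc2, hinf, hsup, hclEs, hclEc, hEs, hEc, hcontr, hdom,
    hvol⟩ := hsh.splitting
  obtain ⟨m, M, hm, hM, hX⟩ := hflow.exists_field_bounds hcomp hnosing
  have hEc' := fun x hx => hEc x (hsub hx)
  have hvol' := fun x hx => hvol x (hsub hx)
  have hXc : ∀ x ∈ Hs, X x ∈ Ec x := fun x hx =>
    hflow.field_mem_of_dominated hinv hK hlam (fun x hx => hsup x (hsub hx))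
      (fun x hx => hEs x (hsub hx)) hEc' (fun x hx => hcontr x (hsub hx))
      (fun x hx => hdom x (hsub hx)) (fun x hx => (hX x hx).2) hx
  obtain ⟨C₀, hC₀, hcorr⟩ :=
    hflow.exists_correction hcomp hinv hK hlam hm hEc' hvol' hXc hX
  have hXnot : ∀ x ∈ Hs, X x ∉ backwardStable φ Ec x := by
    intro x hx hmem
    have h1 := hmem.2.norm
    rw [norm_zero] at h1
    refine absurd (ge_of_tendsto' h1 fun n => ?_) (not_le.2 hm)
    rw [hflow.Dphi_field]
    exact (hX _ (hinv.mem _ hx)).1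
  have hdisj : ∀ x ∈ Hs, Submodule.span ℝ {X x} ⊓ backwardStable φ Ec x = ⊥ := by
    intro x hx
    rw [Submodule.eq_bot_iff]
    rintro w ⟨hw1, hw2⟩
    obtain ⟨c, rfl⟩ := Submodule.mem_span_singleton.1 hw1
    by_contra hc
    have hc0 : c ≠ 0 := fun h => hc (by rw [h, zero_smul])
    exact hXnot x hx ((Submodule.smul_mem_iff _ hc0).1 hw2)
  have hspan : ∀ x ∈ Hs, Submodule.span ℝ {X x} ⊔ backwardStable φ Ec x = Ec x := by
    intro x hx
    refine le_antisymm (sup_le ?_ fun w hw => hw.1) fun u hu => ?_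
    · rw [Submodule.span_singleton_le_iff_mem]; exact hXc x hx
    · obtain ⟨c, hc, -⟩ := hcorr x hx u hu
      exact Submodule.mem_sup.2 ⟨c • X x, Submodule.smul_mem _ _
        (Submodule.mem_span_singleton_self _), _, hc, add_sub_cancel _ _⟩
  have hnorm : ∀ x ∈ Hs, ∀ w ∈ backwardStable φ Ec x, ‖w‖ ≤ C₀ * ‖crossProduct w (X x)‖ := by
    intro x hx w hw
    obtain ⟨c, hc, hle⟩ := hcorr x hx w hw.1
    have hcX : c • X x ∈ Submodule.span ℝ {X x} ⊓ backwardStable φ Ec x := by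
      refine ⟨Submodule.smul_mem _ _ (Submodule.mem_span_singleton_self _), ?_⟩
      have := sub_mem hw hc
      rwa [sub_sub_cancel] at this
    rw [hdisj x hx, Submodule.mem_bot] at hcX
    rwa [hcX, sub_zero] at hle
  have hFu : ∀ x ∈ Hs, ∀ t : ℝ, (backwardStable φ Ec x).map (Dphi φ t x : V3 →ₗ[ℝ] V3) =
      backwardStable φ Ec (φ t x) := fun x hx t => hflow.map_backwardStable hcomp hinv hEc' hx t
  set C := max K (C₀ * (K * (2 * M))) with hC
  have hexp : ∀ x ∈ Hs, ∀ t ≥ 0, ∀ w ∈ backwardStable φ Ec x,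
      ‖Dphi φ (-t) x w‖ ≤ C * Real.exp (-lam * t) * ‖w‖ := by
    intro x hx t ht w hw
    have hw' : Dphi φ (-t) x w ∈ backwardStable φ Ec (φ (-t) x) := by
      rw [← hFu x hx]; exact Submodule.mem_map_of_mem hw
    have hKe : 0 < K * Real.exp (-lam * t) := by positivity
    calc _ ≤ C₀ * ‖crossProduct (Dphi φ (-t) x w) (X (φ (-t) x))‖ :=
          hnorm _ (hinv.mem _ hx) _ hw'
      _ ≤ C₀ * (K * Real.exp (-lam * t) * (2 * (‖w‖ * M))) := by
        refine mul_le_mul_of_nonneg_left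
          ((hflow.field_crossProduct_backward_le hinv hK hEc' hvol' hXc hx ht hw.1).trans
            (mul_le_mul_of_nonneg_left ((norm_crossProduct_le _ _).trans ?_) hKe.le)) hC₀
        have := (hX x hx).2
        gcongr
      _ = C₀ * (K * (2 * M)) * Real.exp (-lam * t) * ‖w‖ := by ring
      _ ≤ _ := by gcongr; exact le_max_right _ _
  refine ⟨Es, backwardStable φ Ec, C, lam, hK.trans (le_max_left _ _), hlam,
    fun x hx => hEs1 x (hsub hx), fun x hx => ?_, ?_, ?_, fun x hx => ?_, fun x hx => ?_,
    hdisj, fun x hx => hEs x (hsub hx), hFu, fun x hx t ht v hv => ?_, hexp⟩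
  · have h1 := Submodule.finrank_sup_add_finrank_inf_eq (Submodule.span ℝ {X x})
      (backwardStable φ Ec x)
    rw [hspan x hx, hdisj x hx, finrank_bot, hEc2 x (hsub hx),
      finrank_span_singleton (hnosing x hx)] at h1
    omega
  · have e : {q : V3 × V3 | q.1 ∈ Hs ∧ q.2 ∈ Es q.1} =
        Prod.fst ⁻¹' Hs ∩ {q : V3 × V3 | q.1 ∈ Λ ∧ q.2 ∈ Es q.1} := by
      ext q
      exact ⟨fun h => ⟨h.1, hsub h.1, h.2⟩, fun h => ⟨h.1, h.2.2⟩⟩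
    rw [e]
    exact (hcomp.isClosed.preimage continuous_fst).inter hclEs
  · have e : {q : V3 × V3 | q.1 ∈ Hs ∧ q.2 ∈ backwardStable φ Ec q.1} =
        (Prod.fst ⁻¹' Hs ∩ {q : V3 × V3 | q.1 ∈ Λ ∧ q.2 ∈ Ec q.1}) ∩
          ⋂ n : ℕ, {q : V3 × V3 | ‖Dphi φ (-n) q.1 q.2‖ ≤
            C * Real.exp (-lam * n) * ‖q.2‖} := by
      ext q
      constructor
      · rintro ⟨h1, h2⟩
        exact ⟨⟨h1, hsub h1, h2.1⟩, mem_iInter.2 fun n => hexp _ h1 n (Nat.cast_nonneg n) _ h2⟩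
      · rintro ⟨⟨h1, -, h2⟩, h3⟩
        refine ⟨h1, h2, squeeze_zero_norm (fun n => mem_iInter.1 h3 n) ?_⟩
        have hlim : Tendsto (fun n : ℕ => Real.exp (-lam * n)) atTop (𝓝 0) :=
          Real.tendsto_exp_atBot.comp
            (tendsto_natCast_atTop_atTop.const_mul_atTop_of_neg (by linarith))
        simpa using (hlim.const_mul C).mul_const ‖q.2‖
    rw [e]
    exact ((hcomp.isClosed.preimage continuous_fst).inter hclEc).inter (isClosed_iInter fun n =>
      isClosed_le (hflow.continuous_Dphi _).norm (continuous_const.mul continuous_snd.norm))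
  · rw [hspan x hx]; exact hsup x (hsub hx)
  · rw [hspan x hx]; exact hinf x (hsub hx)
  · refine (hcontr x (hsub hx) t ht v hv).trans ?_
    gcongr
    exact le_max_left _ _

end
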